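/- arXiv:1107.0101 — 2 statements merged into one kernel-verified Lean document; each statement's English description precedes it below -/
import Mathlib

section
/- Let ω ∈ (π/2, π) and q > 0. Then the constrained class 𝒞 is non-empty. Moreover, if (a,f,g) ∈ 𝒞, then 0 < g(r) < q for all r > 0, and g is the unique minimizer of the functional G ↦ E₂(a,G) over all functions G locally absolutely continuous on (0,∞) with lim_{r→∞} G(r) = q. -/
open Real MeasureTheory Set Filter

noncomputable section

/-- `h` is continuous on `[0,∞)` and absolutely continuous on every compact
subinterval of `(0,∞)` (encoded via the fundamental theorem of calculus,
with `deriv h` playing the role of the a.e. derivative `h'`). -/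
def LocAC (h : ℝ → ℝ) : Prop :=
  ContinuousOn h (Set.Ici 0) ∧
  ∀ s t : ℝ, 0 < s → s ≤ t →
    IntervalIntegrable (deriv h) MeasureTheory.volume s t ∧
    h t - h s = ∫ r in s..t, deriv h r

/-- `h` is locally absolutely continuous on `(0,∞)`, with derivative `deriv h`. -/
def LocACIoi (h : ℝ → ℝ) : Prop :=
  ∀ s t : ℝ, 0 < s → s ≤ t →
    IntervalIntegrable (deriv h) MeasureTheory.volume s t ∧
    h t - h s = ∫ r in s..t, deriv h r

/-- The density `𝓔₁`. -/
def calE1 (κ : ℝ) (a f : ℝ → ℝ) (r : ℝ) : ℝ :=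
  2 * (2 * (deriv a r) ^ 2 + ((a r) ^ 2 - 1) ^ 2 / r ^ 2)
    + (1 / 2) * (r ^ 2 * (deriv f r) ^ 2 + 2 * (a r) ^ 2 * Real.sin (f r) ^ 2)
    + 2 * κ * (a r) ^ 2 * Real.sin (f r) ^ 2
        * (2 * (deriv f r) ^ 2 + (a r) ^ 2 * Real.sin (f r) ^ 2 / r ^ 2)

/-- The density `𝓔₂`. -/
def calE2 (a g : ℝ → ℝ) (r : ℝ) : ℝ :=
  r ^ 2 * (deriv g r) ^ 2 + 2 * (a r) ^ 2 * (g r) ^ 2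

/-- Finite energy: `E(a,f,g) = ∫₀^∞ (𝓔₁ + 𝓔₂) dr < ∞`. -/
def FiniteEnergy (κ : ℝ) (a f g : ℝ → ℝ) : Prop :=
  MeasureTheory.IntegrableOn (fun r => calE1 κ a f r + calE2 a g r) (Set.Ioi 0)

/-- The action `L(a,f,g) = ∫₀^∞ (𝓔₁ - 𝓔₂) dr`. -/
def actionL (κ : ℝ) (a f g : ℝ → ℝ) : ℝ :=
  ∫ r in Set.Ioi (0 : ℝ), (calE1 κ a f r - calE2 a g r)

/-- The admissible class `𝒜`. -/
structure Admissible (κ ω q : ℝ) (a f g : ℝ → ℝ) : Prop where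
  locAC_a : LocAC a
  locAC_f : LocAC f
  locAC_g : LocAC g
  a_zero : a 0 = 1
  f_zero : f 0 = 0
  a_infty : Filter.Tendsto a Filter.atTop (nhds 0)
  f_infty : Filter.Tendsto f Filter.atTop (nhds (Real.pi - ω))
  g_infty : Filter.Tendsto g Filter.atTop (nhds q)
  finite_energy : FiniteEnergy κ a f g

/-- The constrained class `𝒞`: members of `𝒜` such that
`∫₀^∞ (r² g' G' + 2 a² g G) dr = 0` for every admissible test function `G`. -/
def Constrained (κ ω q : ℝ) (a f g : ℝ → ℝ) : Prop :=
  Admissible κ ω q a f g ∧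
  ∀ G : ℝ → ℝ, LocACIoi G → Filter.Tendsto G Filter.atTop (nhds 0) →
    MeasureTheory.IntegrableOn
      (fun r => r ^ 2 * (deriv G r) ^ 2 + 2 * (a r) ^ 2 * (G r) ^ 2) (Set.Ioi 0) →
    MeasureTheory.IntegrableOn
      (fun r => r ^ 2 * deriv g r * deriv G r + 2 * (a r) ^ 2 * g r * G r) (Set.Ioi 0) ∧
    ∫ r in Set.Ioi (0 : ℝ), (r ^ 2 * deriv g r * deriv G r + 2 * (a r) ^ 2 * g r * G r) = 0

/-- The functional `E₂(a,G) = ∫₀^∞ (r² G'² + 2 a² G²) dr`, valued in `[0,∞]`. -/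
def E2lint (a G : ℝ → ℝ) : ENNReal :=
  ∫⁻ r in Set.Ioi (0 : ℝ),
    ENNReal.ofReal (r ^ 2 * (deriv G r) ^ 2 + 2 * (a r) ^ 2 * (G r) ^ 2)


theorem AbsolutelyContinuousOnInterval.of_dist_le {f g : ℝ → ℝ} {s t : ℝ}
    (hf : AbsolutelyContinuousOnInterval f s t)
    (h : ∀ x ∈ uIcc s t, ∀ y ∈ uIcc s t, dist (g x) (g y) ≤ dist (f x) (f y)) :
    AbsolutelyContinuousOnInterval g s t := by
  rw [absolutelyContinuousOnInterval_iff] at hf ⊢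
  intro ε hε
  obtain ⟨δ, hδ, H⟩ := hf ε hε
  refine ⟨δ, hδ, fun E hE hlt => lt_of_le_of_lt (Finset.sum_le_sum fun i hi => ?_) (H E hE hlt)⟩
  exact h _ (hE.1 i hi).1 _ (hE.1 i hi).2

theorem locACIoi_iff {h : ℝ → ℝ} :
    LocACIoi h ↔ ∀ s t : ℝ, 0 < s → s ≤ t → AbsolutelyContinuousOnInterval h s t := by
  refine ⟨fun H s t hs hst => ?_, fun H s t hs hst =>
    ⟨(H s t hs hst).intervalIntegrable_deriv, (H s t hs hst).integral_deriv_eq_sub.symm⟩⟩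
  refine ((H s t hs hst).1.absolutelyContinuousOnInterval_intervalIntegral
    left_mem_uIcc).of_dist_le fun x hx y hy => ?_
  rw [uIcc_of_le hst] at hx hy
  rw [← (H s x hs hx.1).2, ← (H s y hs hy.1).2, dist_sub_right]

namespace LocACIoi

variable {u v : ℝ → ℝ}

theorem continuousOn (hu : LocACIoi u) : ContinuousOn u (Ioi 0) := by
  intro x (hx : 0 < x)
  have h := (locACIoi_iff.1 hu (x / 2) (x + 1) (by linarith) (by linarith)).continuousOn
  rw [uIcc_of_le (by linarith)] at h
  exact (h.continuousAt (Icc_mem_nhds (by linarith) (by linarith))).continuousWithinAt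

theorem ae_differentiableAt (hu : LocACIoi u) :
    ∀ᵐ x ∂volume.restrict (Ioi (0 : ℝ)), DifferentiableAt ℝ u x := by
  rw [ae_restrict_iff' measurableSet_Ioi]
  have h : ∀ n : ℕ, ∀ᵐ x : ℝ, x ∈ uIcc (1 / ((n : ℝ) + 1)) (n + 1) → DifferentiableAt ℝ u x := by
    intro n
    refine (locACIoi_iff.1 hu _ _ (by positivity) ?_).ae_differentiableAt
    rw [div_le_iff₀ (by positivity)]
    nlinarith [n.cast_nonneg (α := ℝ)]
  filter_upwards [ae_all_iff.2 h] with x hx (hx0 : 0 < x)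
  obtain ⟨n, hn⟩ := exists_nat_gt (max x (1 / x))
  refine hx n (Icc_subset_uIcc ⟨?_, ?_⟩)
  · rw [div_le_iff₀ (by positivity)]
    have := (le_max_right x (1 / x)).trans hn.le
    rw [div_le_iff₀ hx0] at this
    nlinarith
  · linarith [le_max_left x (1 / x)]

theorem sub (hu : LocACIoi u) (hv : LocACIoi v) : LocACIoi (fun r => u r - v r) :=
  locACIoi_iff.2 fun s t hs hst => (locACIoi_iff.1 hu s t hs hst).sub (locACIoi_iff.1 hv s t hs hst)

theorem of_hasDerivAt {u' : ℝ → ℝ} (hu : ∀ r, 0 < r → HasDerivAt u (u' r) r)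
    (hu' : ContinuousOn u' (Ioi 0)) : LocACIoi u := by
  intro s t hs hst
  have hsub : uIcc s t ⊆ Ioi 0 := by
    rw [uIcc_of_le hst]; exact fun x hx => hs.trans_le hx.1
  have hcont : ContinuousOn (deriv u) (uIcc s t) :=
    (hu'.mono hsub).congr fun x hx => (hu x (hsub hx)).deriv
  refine ⟨hcont.intervalIntegrable, ?_⟩
  rw [intervalIntegral.integral_deriv_eq_sub (fun x hx => (hu x (hsub hx)).differentiableAt)
    hcont.intervalIntegrable]

theorem measurable_energy {a : ℝ → ℝ} (ha : ContinuousOn a (Ioi 0)) (hu : LocACIoi u) :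
    AEStronglyMeasurable (fun r => r ^ 2 * (deriv u r) ^ 2 + 2 * (a r) ^ 2 * (u r) ^ 2)
      (volume.restrict (Ioi (0 : ℝ))) := by
  refine AEStronglyMeasurable.add ?_ ?_
  · exact ((measurable_id.pow_const 2).mul ((measurable_deriv u).pow_const 2)).aestronglyMeasurable
  · exact ((continuousOn_const.mul (ha.pow 2)).mul
      (hu.continuousOn.pow 2)).aestronglyMeasurable measurableSet_Ioi

/-- A locally absolutely continuous function on `(0,∞)` with zero Dirichlet energy that vanishes at
infinity is zero. -/
theorem eqOn_zero {a : ℝ → ℝ} (hu : LocACIoi u) (hlim : Tendsto u atTop (nhds 0))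
    (h : (fun r => r ^ 2 * (deriv u r) ^ 2 + 2 * (a r) ^ 2 * (u r) ^ 2)
      =ᵐ[volume.restrict (Ioi (0 : ℝ))] 0) : EqOn u 0 (Ioi 0) := by
  have hd : ∀ᵐ r, r ∈ Ioi (0 : ℝ) → deriv u r = 0 := by
    filter_upwards [(ae_restrict_iff' measurableSet_Ioi).1 h] with r hr (hr0 : 0 < r)
    have h1 : r ^ 2 * (deriv u r) ^ 2 + 2 * (a r) ^ 2 * (u r) ^ 2 = 0 := hr hr0
    have h2 : r ^ 2 * (deriv u r) ^ 2 = 0 := le_antisymm (by nlinarith [sq_nonneg (a r * u r)])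
      (by positivity)
    simpa [hr0.ne'] using h2
  intro s (hs : 0 < s)
  refine tendsto_nhds_unique (tendsto_const_nhds.congr' ?_) hlim
  filter_upwards [eventually_ge_atTop s] with t hst
  have : ∫ r in s..t, deriv u r = ∫ r in s..t, (0 : ℝ) := by
    refine intervalIntegral.integral_congr_ae ?_
    filter_upwards [hd] with r hr hrm
    rw [uIoc_of_le hst] at hrm
    exact hr (hs.trans hrm.1)
  have h2 := (hu s t hs hst).2
  simp only [this, intervalIntegral.integral_zero] at h2
  linarith

end LocACIoi

theorem LocAC.locACIoi {h : ℝ → ℝ} (hh : LocAC h) : LocACIoi h := hh.2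

theorem LocAC.continuousAt {h : ℝ → ℝ} (hh : LocAC h) {r : ℝ} (hr : 0 < r) : ContinuousAt h r :=
  hh.1.continuousAt (Ici_mem_nhds hr)

section Constrained

variable {κ ω q : ℝ} {a f g : ℝ → ℝ}

theorem calE1_nonneg (hκ : 0 < κ) (r : ℝ) : 0 ≤ calE1 κ a f r := by
  unfold calE1; positivity

theorem calE2_nonneg (r : ℝ) : 0 ≤ calE2 a g r := by
  unfold calE2; positivity

theorem Admissible.integrableOn_calE2 (hκ : 0 < κ) (h : Admissible κ ω q a f g) :
    IntegrableOn (calE2 a g) (Ioi 0) := by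
  refine h.finite_energy.mono'
    (h.locAC_g.locACIoi.measurable_energy h.locAC_a.locACIoi.continuousOn) ?_
  refine ae_of_all _ fun r => ?_
  rw [Real.norm_of_nonneg (calE2_nonneg r)]
  exact le_add_of_nonneg_left (calE1_nonneg hκ r)

/-- The pointwise identity behind testing with a truncation. -/
theorem deriv_max_zero_sq {u : ℝ → ℝ} {r : ℝ} (hu : ContinuousAt u r) :
    (deriv (fun x => max (u x) 0) r) ^ 2 = deriv u r * deriv (fun x => max (u x) 0) r := by
  rcases lt_trichotomy (u r) 0 with h | h | h
  · have : (fun x => max (u x) 0) =ᶠ[nhds r] fun _ => 0 := by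
      filter_upwards [hu.eventually_lt continuousAt_const h] with x hx
      exact max_eq_right hx.le
    simp [this.deriv_eq]
  · have : IsLocalMin (fun x => max (u x) 0) r := by
      refine Eventually.of_forall fun x => ?_
      simp [h]
    simp [this.deriv_eq_zero]
  · have : (fun x => max (u x) 0) =ᶠ[nhds r] u := by
      filter_upwards [continuousAt_const.eventually_lt hu h] with x hx
      exact max_eq_left hx.le
    rw [this.deriv_eq, sq]

theorem Constrained.le_of_tendsto_max (hκ : 0 < κ) (h : Constrained κ ω q a f g) {σ c : ℝ}
    (hσ : σ ^ 2 = 1) (hc : 0 ≤ c) (hlim : Tendsto (fun r => max (σ * g r - c) 0) atTop (nhds 0)) :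
    ∀ r ∈ Ioi (0 : ℝ), σ * g r ≤ c := by
  obtain ⟨hA, hT⟩ := h
  set T : ℝ → ℝ := fun r => max (σ * g r - c) 0 with hTdef
  have hσ' : |σ| = 1 := by rw [← sq_eq_sq₀ (abs_nonneg _) zero_le_one, sq_abs, hσ]; norm_num
  have hTac : LocACIoi T := locACIoi_iff.2 fun s t hs hst =>
    (locACIoi_iff.1 hA.locAC_g.locACIoi s t hs hst).of_dist_le fun x _ y _ => by
      calc dist (T x) (T y) ≤ |(σ * g x - c) - (σ * g y - c)| := abs_max_sub_max_le_abs _ _ _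
        _ = dist (g x) (g y) := by
          rw [show (σ * g x - c) - (σ * g y - c) = σ * (g x - g y) by ring, abs_mul, hσ', one_mul,
            Real.dist_eq]
  have hderiv : ∀ r, 0 < r → (deriv T r) ^ 2 = σ * deriv g r * deriv T r := by
    intro r hr
    have h1 := deriv_max_zero_sq (u := fun x => σ * g x - c)
      ((continuousAt_const.mul (hA.locAC_g.continuousAt hr)).sub continuousAt_const)
    rwa [deriv_sub_const, deriv_const_mul_field] at h1
  have hderiv_le : ∀ r, 0 < r → (deriv T r) ^ 2 ≤ (deriv g r) ^ 2 := by
    intro r hr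
    have := hderiv r hr
    have : (σ * deriv g r) ^ 2 = (deriv g r) ^ 2 := by rw [mul_pow, hσ, one_mul]
    nlinarith [sq_nonneg (σ * deriv g r - deriv T r)]
  have hT0 : ∀ r, 0 ≤ T r := fun r => le_max_right _ _
  have hTg : ∀ r, (T r) ^ 2 ≤ σ * g r * T r := by
    intro r
    rcases max_choice (σ * g r - c) 0 with h | h
    · have h0 := hT0 r
      have : T r = σ * g r - c := h
      nlinarith
    · have : T r = 0 := h
      simp [this]
  have hTg_le : ∀ r, (T r) ^ 2 ≤ (g r) ^ 2 := by
    intro r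
    have : (σ * g r) ^ 2 = (g r) ^ 2 := by rw [mul_pow, hσ, one_mul]
    nlinarith [sq_nonneg (σ * g r - T r), hTg r]
  have hE := hA.integrableOn_calE2 hκ
  have hET : IntegrableOn (fun r => r ^ 2 * (deriv T r) ^ 2 + 2 * (a r) ^ 2 * (T r) ^ 2)
      (Ioi 0) := by
    refine hE.mono' (hTac.measurable_energy hA.locAC_a.locACIoi.continuousOn) ?_
    refine (ae_restrict_iff' measurableSet_Ioi).2 (ae_of_all _ fun r hr => ?_)
    rw [Real.norm_of_nonneg (by positivity)]
    unfold calE2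
    have := hderiv_le r hr
    have := hTg_le r
    gcongr
  obtain ⟨hI, hI0⟩ := hT T hTac hlim hET
  have hle : ∫ r in Ioi (0 : ℝ), (r ^ 2 * (deriv T r) ^ 2 + 2 * (a r) ^ 2 * (T r) ^ 2) ≤
      ∫ r in Ioi (0 : ℝ), σ * (r ^ 2 * deriv g r * deriv T r + 2 * (a r) ^ 2 * g r * T r) := by
    refine setIntegral_mono_on hET (hI.const_mul σ) measurableSet_Ioi fun r hr => ?_
    have h1 := hderiv r hr
    have h2 := mul_le_mul_of_nonneg_left (hTg r) (by positivity : 0 ≤ 2 * (a r) ^ 2)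
    rw [h1]
    nlinarith
  rw [integral_const_mul, hI0, mul_zero] at hle
  have hz := (setIntegral_eq_zero_iff_of_nonneg_ae (ae_of_all _ fun r => by positivity) hET).1
    (le_antisymm hle (integral_nonneg fun r => by positivity))
  intro r hr
  have h0 : T r = 0 := hTac.eqOn_zero hlim hz hr
  have := le_max_left (σ * g r - c) 0
  change _ ≤ T r at this
  linarith

theorem Constrained.nonneg (hκ : 0 < κ) (hq : 0 < q) (h : Constrained κ ω q a f g) :
    ∀ r ∈ Ioi (0 : ℝ), 0 ≤ g r := by
  have := h.le_of_tendsto_max hκ (σ := -1) (c := 0) (by norm_num) le_rfl ?_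
  · intro r hr; linarith [this r hr]
  · have h1 := ((h.1.g_infty.const_mul (-1)).sub_const 0).max (tendsto_const_nhds (x := (0 : ℝ)))
    rwa [max_eq_right (by linarith)] at h1

theorem Constrained.le_q (hκ : 0 < κ) (hq : 0 < q) (h : Constrained κ ω q a f g) :
    ∀ r ∈ Ioi (0 : ℝ), g r ≤ q := by
  have := h.le_of_tendsto_max hκ (σ := 1) (c := q) (by norm_num) hq.le ?_
  · intro r hr; linarith [this r hr]
  · have h1 := ((h.1.g_infty.const_mul 1).sub_const q).max (tendsto_const_nhds (x := (0 : ℝ)))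
    rwa [max_eq_right (by linarith)] at h1

theorem integrableOn_calE2_of_E2lint_ne_top {G : ℝ → ℝ} (ha : ContinuousOn a (Ioi 0))
    (hG : LocACIoi G) (h : E2lint a G ≠ ⊤) : IntegrableOn (calE2 a G) (Ioi 0) := by
  refine ⟨hG.measurable_energy ha, ?_⟩
  rw [hasFiniteIntegral_iff_ofReal (ae_of_all _ calE2_nonneg)]
  exact h.lt_top

theorem E2lint_eq_ofReal {G : ℝ → ℝ} (h : IntegrableOn (calE2 a G) (Ioi 0)) :
    E2lint a G = ENNReal.ofReal (∫ r in Ioi (0 : ℝ), calE2 a G r) :=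
  (ofReal_integral_eq_lintegral_ofReal h (ae_of_all _ calE2_nonneg)).symm

/-- Pythagoras' identity for the quadratic form `E₂(a,·)` around the constrained function `g`. -/
theorem Constrained.integral_calE2_eq (hκ : 0 < κ) (h : Constrained κ ω q a f g) {G : ℝ → ℝ}
    (hG : LocACIoi G) (hlim : Tendsto G atTop (nhds q)) (hE : IntegrableOn (calE2 a G) (Ioi 0)) :
    IntegrableOn (calE2 a fun r => G r - g r) (Ioi 0) ∧
      ∫ r in Ioi (0 : ℝ), calE2 a G r =
        (∫ r in Ioi (0 : ℝ), calE2 a g r) + ∫ r in Ioi (0 : ℝ), calE2 a (fun r => G r - g r) r := by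
  obtain ⟨hA, hT⟩ := h
  have hg := hA.locAC_g.locACIoi
  have hEg := hA.integrableOn_calE2 hκ
  have hφ := hG.sub hg
  have hd : ∀ᵐ r ∂volume.restrict (Ioi (0 : ℝ)),
      deriv (fun r => G r - g r) r = deriv G r - deriv g r := by
    filter_upwards [hG.ae_differentiableAt, hg.ae_differentiableAt] with r h1 h2
    exact deriv_fun_sub h1 h2
  have hEφ : IntegrableOn (calE2 a fun r => G r - g r) (Ioi 0) := by
    refine ((hE.const_mul 2).add (hEg.const_mul 2)).mono'
      (hφ.measurable_energy hA.locAC_a.locACIoi.continuousOn) ?_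
    filter_upwards [hd] with r hr
    rw [Real.norm_of_nonneg (calE2_nonneg r)]
    simp only [calE2, hr, Pi.add_apply]
    nlinarith [sq_nonneg (r * (deriv G r + deriv g r)), sq_nonneg (a r * (G r + g r))]
  have hlim0 : Tendsto (fun r => G r - g r) atTop (nhds 0) := by
    simpa using hlim.sub hA.g_infty
  obtain ⟨hI, hI0⟩ := hT _ hφ hlim0 hEφ
  refine ⟨hEφ, ?_⟩
  have : ∫ r in Ioi (0 : ℝ), calE2 a G r = ∫ r in Ioi (0 : ℝ),
      ((calE2 a g r + calE2 a (fun r => G r - g r) r) +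
        2 * (r ^ 2 * deriv g r * deriv (fun r => G r - g r) r
          + 2 * (a r) ^ 2 * g r * (G r - g r))) := by
    refine integral_congr_ae ?_
    filter_upwards [hd] with r hr
    simp only [calE2, hr]
    ring
  have hsum : IntegrableOn (fun r => calE2 a g r + calE2 a (fun r => G r - g r) r) (Ioi 0) :=
    hEg.add hEφ
  rw [this, integral_add hsum (hI.const_mul 2), integral_add hEg hEφ,
    integral_const_mul, hI0, mul_zero, add_zero]

theorem Constrained.E2lint_le (hκ : 0 < κ) (h : Constrained κ ω q a f g) {G : ℝ → ℝ}
    (hG : LocACIoi G) (hlim : Tendsto G atTop (nhds q)) : E2lint a g ≤ E2lint a G := by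
  by_cases htop : E2lint a G = ⊤
  · simp [htop]
  have hE := integrableOn_calE2_of_E2lint_ne_top h.1.locAC_a.locACIoi.continuousOn hG htop
  rw [E2lint_eq_ofReal hE, E2lint_eq_ofReal (h.1.integrableOn_calE2 hκ),
    (h.integral_calE2_eq hκ hG hlim hE).2]
  exact ENNReal.ofReal_le_ofReal (le_add_of_nonneg_right (integral_nonneg calE2_nonneg))

theorem Constrained.eqOn_of_E2lint_le (hκ : 0 < κ) (h : Constrained κ ω q a f g) {G : ℝ → ℝ}
    (hG : LocACIoi G) (hlim : Tendsto G atTop (nhds q)) (hle : E2lint a G ≤ E2lint a g) :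
    EqOn G g (Ioi 0) := by
  have hEg := E2lint_eq_ofReal (h.1.integrableOn_calE2 hκ)
  have hE := integrableOn_calE2_of_E2lint_ne_top h.1.locAC_a.locACIoi.continuousOn hG
    (ne_top_of_le_ne_top (hEg ▸ ENNReal.ofReal_ne_top) hle)
  obtain ⟨hEφ, heq⟩ := h.integral_calE2_eq hκ hG hlim hE
  rw [hEg, E2lint_eq_ofReal hE, ENNReal.ofReal_le_ofReal_iff (integral_nonneg calE2_nonneg)] at hle
  have hz := (setIntegral_eq_zero_iff_of_nonneg_ae (ae_of_all _ calE2_nonneg) hEφ).1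
    (le_antisymm (by linarith) (integral_nonneg calE2_nonneg))
  have hlim0 : Tendsto (fun r => G r - g r) atTop (nhds 0) := by
    simpa using hlim.sub h.1.g_infty
  intro r hr
  exact sub_eq_zero.1 ((hG.sub h.1.locAC_g.locACIoi).eqOn_zero hlim0 hz hr)

theorem hasDerivAt_intervalIntegral_of_continuousOn {b : ℝ → ℝ} (hb : ContinuousOn b (Ioi 0))
    {s r : ℝ} (hs : 0 < s) (hr : 0 < r) : HasDerivAt (fun y => ∫ x in s..y, b x) (b r) r := by
  refine intervalIntegral.integral_hasDerivAt_right
    (hb.mono fun x hx => (lt_min hs hr).trans_le hx.1).intervalIntegrable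
    (hb.stronglyMeasurableAtFilter isOpen_Ioi r hr) (hb.continuousAt (Ioi_mem_nhds hr))

/-- Regularity for the weak equation `(r² g')' = 2 a² g`: the flux `p = r² g'` is differentiable. -/
theorem Constrained.exists_flux (hκ : 0 < κ) (h : Constrained κ ω q a f g) {s t : ℝ} (hs : 0 < s)
    (hst : s < t) : ∃ p : ℝ → ℝ, ∀ r ∈ Ioo s t,
      HasDerivAt g (p r / r ^ 2) r ∧ HasDerivAt p (2 * (a r) ^ 2 * g r) r := by
  obtain ⟨hA, hT⟩ := h
  have hgac := hA.locAC_g.locACIoi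
  have hac := hA.locAC_a.locACIoi.continuousOn
  have hb : ContinuousOn (fun x => 2 * (a x) ^ 2 * g x) (Ioi 0) :=
    (continuousOn_const.mul (hac.pow 2)).mul hgac.continuousOn
  have hsub : Icc s t ⊆ Ioi 0 := fun x hx => hs.trans_le hx.1
  have hsub' : Ioc s t ⊆ Ioi 0 := Ioc_subset_Icc_self.trans hsub
  set H : ℝ → ℝ := fun r => ∫ x in s..r, 2 * (a x) ^ 2 * g x with hHdef
  have hH : ∀ r, 0 < r → HasDerivAt H (2 * (a r) ^ 2 * g r) r := fun r hr =>
    hasDerivAt_intervalIntegral_of_continuousOn hb hs hr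
  have hHac : LocACIoi H := LocACIoi.of_hasDerivAt hH hb
  set u : ℝ → ℝ := fun r => r ^ 2 * deriv g r - H r with hudef
  have hu : IntervalIntegrable u volume s t := by
    refine ((hgac s t hs hst.le).1.continuousOn_mul (by fun_prop)).sub ?_
    refine (hHac.continuousOn.mono ?_).intervalIntegrable
    rwa [uIcc_of_le hst.le]
  set c : ℝ := (∫ x in s..t, u x) / (t - s) with hcdef
  set w : ℝ → ℝ := (Ioc s t).indicator fun r => u r - c with hwdef
  have hw : Integrable w := by
    rw [hwdef, integrable_indicator_iff measurableSet_Ioc]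
    exact ((intervalIntegrable_iff_integrableOn_Ioc_of_le hst.le).1
      (hu.sub intervalIntegrable_const))
  set G : ℝ → ℝ := fun r => ∫ x in s..r, w x with hGdef
  have hGac : LocACIoi G := by
    refine locACIoi_iff.2 fun x y hx hxy => ?_
    refine (hw.intervalIntegrable.absolutelyContinuousOnInterval_intervalIntegral
      (a := min x s) (b := max y s) ?_).mono ?_
    · exact Icc_subset_uIcc ⟨min_le_right _ _, le_max_right _ _⟩
    · rw [uIcc_of_le hxy]
      exact (Icc_subset_Icc (min_le_left _ _) (le_max_left _ _)).trans Icc_subset_uIcc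
  have hGd : ∀ᵐ x, deriv G x = w x := by
    filter_upwards [LocallyIntegrable.ae_hasDerivAt_integral hw.locallyIntegrable] with x hx
    exact (hx s).deriv
  have hGs : ∀ r ≤ s, G r = 0 := by
    intro r hr
    refine intervalIntegral.integral_zero_ae (ae_of_all _ fun x hx => ?_)
    rw [uIoc_of_ge hr] at hx
    exact indicator_of_notMem (fun hx' => hx'.1.not_ge hx.2) _
  have hGt' : G t = 0 := by
    have : G t = ∫ x in s..t, (u x - c) := by
      refine intervalIntegral.integral_congr_ae (ae_of_all _ fun x hx => ?_)
      rw [uIoc_of_le hst.le] at hx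
      exact indicator_of_mem hx _
    rw [this, intervalIntegral.integral_sub hu intervalIntegrable_const,
      intervalIntegral.integral_const, smul_eq_mul, hcdef, mul_div_cancel₀ _ (sub_pos.2 hst).ne',
      sub_self]
  have hGt : ∀ r, t ≤ r → G r = 0 := by
    intro r hr
    have h1 : G t + ∫ x in t..r, w x = G r :=
      intervalIntegral.integral_add_adjacent_intervals hw.intervalIntegrable hw.intervalIntegrable
    rw [← h1, hGt', zero_add]
    refine intervalIntegral.integral_zero_ae (ae_of_all _ fun x hx => ?_)
    rw [uIoc_of_le hr] at hx
    exact indicator_of_notMem (fun hx' => hx.1.not_ge hx'.2) _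
  have hG0 : ∀ r, r ∉ Ioc s t → G r = 0 := by
    intro r hr
    rcases le_or_gt r s with h | h
    · exact hGs r h
    · exact hGt r (le_of_not_gt fun h' => hr ⟨h, h'.le⟩)
  have hlim : Tendsto G atTop (nhds 0) := by
    refine tendsto_const_nhds.congr' ?_
    filter_upwards [eventually_ge_atTop t] with r hr using (hGt r hr).symm
  have hEt : IntegrableOn (fun r => r ^ 2 * (deriv G r) ^ 2 + 2 * (a r) ^ 2 * (G r) ^ 2)
      (Ioc s t) := by
    have hcont : ContinuousOn
        (fun r => 2 * r ^ 2 * (H r + c) ^ 2 + 2 * (a r) ^ 2 * (G r) ^ 2) (Icc s t) := by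
      have h1 := hHac.continuousOn.mono hsub
      have h2 := hGac.continuousOn.mono hsub
      have h3 := hac.mono hsub
      fun_prop
    refine (((hA.integrableOn_calE2 hκ).mono_set hsub').const_mul (2 * t ^ 4)|>.add
      (hcont.integrableOn_Icc.mono_set Ioc_subset_Icc_self)).mono'
      ((hGac.measurable_energy hac).mono_measure (Measure.restrict_mono hsub' le_rfl)) ?_
    refine (ae_restrict_iff' measurableSet_Ioc).2 ?_
    filter_upwards [hGd] with r hr hrm
    rw [Real.norm_of_nonneg (by positivity), hr, hwdef, indicator_of_mem hrm]
    simp only [Pi.add_apply, calE2, hudef]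
    have h4 : r ^ 4 ≤ t ^ 4 := pow_le_pow_left₀ (hs.trans hrm.1).le hrm.2 4
    have h5 := mul_le_mul_of_nonneg_right h4 (by positivity :
      0 ≤ 2 * (r ^ 2 * (deriv g r) ^ 2 + 2 * (a r) ^ 2 * (g r) ^ 2))
    have h6 : 0 ≤ r ^ 4 * (2 * (2 * (a r) ^ 2 * (g r) ^ 2)) := by positivity
    nlinarith [sq_nonneg (r * (r ^ 2 * deriv g r + (H r + c)))]
  have hE : IntegrableOn (fun r => r ^ 2 * (deriv G r) ^ 2 + 2 * (a r) ^ 2 * (G r) ^ 2)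
      (Ioi 0) := by
    refine hEt.of_ae_sdiff_eq_zero measurableSet_Ioi.nullMeasurableSet ?_
    filter_upwards [hGd] with r hr hrm
    rw [hr, hwdef, indicator_of_notMem hrm.2, hG0 r hrm.2]
    ring
  obtain ⟨hI, hI0⟩ := hT G hGac hlim hE
  rw [setIntegral_eq_of_subset_of_ae_sdiff_eq_zero measurableSet_Ioi.nullMeasurableSet hsub'
    (by
      filter_upwards [hGd] with r hr hrm
      rw [hr, hwdef, indicator_of_notMem hrm.2, hG0 r hrm.2]
      ring)] at hI0
  have hIt := hI.mono_set hsub'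
  have hHst := locACIoi_iff.1 hHac s t hs hst.le
  have hGst := locACIoi_iff.1 hGac s t hs hst.le
  have hprod : IntegrableOn (fun x => deriv H x * G x + H x * deriv G x) (Ioc s t) := by
    rw [← intervalIntegrable_iff_integrableOn_Ioc_of_le hst.le]
    exact (hHst.intervalIntegrable_deriv.mul_continuousOn hGst.continuousOn).add
      (hGst.intervalIntegrable_deriv.continuousOn_mul hHst.continuousOn)
  have hparts := hHst.integral_deriv_mul_eq_sub hGst
  rw [intervalIntegral.integral_of_le hst.le, hGt', hGs s le_rfl, mul_zero, mul_zero,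
    sub_zero] at hparts
  have hGint := (hGac s t hs hst.le).1
  rw [intervalIntegrable_iff_integrableOn_Ioc_of_le hst.le] at hGint
  have hG00 := (hGac s t hs hst.le).2
  rw [intervalIntegral.integral_of_le hst.le, hGt', hGs s le_rfl, sub_zero] at hG00
  have hsq : (fun r => (r ^ 2 * deriv g r * deriv G r + 2 * (a r) ^ 2 * g r * G r) -
      (deriv H r * G r + H r * deriv G r) - c * deriv G r)
      =ᵐ[volume.restrict (Ioc s t)] fun r => (u r - c) ^ 2 := by
    refine (ae_restrict_iff' measurableSet_Ioc).2 ?_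
    filter_upwards [hGd] with r hr hrm
    rw [hr, hwdef, indicator_of_mem hrm, (hH r (hsub' hrm)).deriv]
    simp only [hudef]
    ring
  have hdiff : IntegrableOn (fun r => (r ^ 2 * deriv g r * deriv G r + 2 * (a r) ^ 2 * g r * G r) -
      (deriv H r * G r + H r * deriv G r)) (Ioc s t) := hIt.sub hprod
  have hKint := hdiff.sub (hGint.const_mul c)
  have hzero : ∫ r in Ioc s t, (u r - c) ^ 2 = 0 := by
    rw [← integral_congr_ae hsq, integral_sub hdiff (hGint.const_mul c),
      integral_sub hIt hprod, hI0, hparts, integral_const_mul, ← hG00]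
    ring
  have hae := (setIntegral_eq_zero_iff_of_nonneg_ae (ae_of_all _ fun r => sq_nonneg (u r - c))
    (hKint.congr hsq)).1 hzero
  have hae' : ∀ᵐ r, r ∈ Ioc s t → deriv g r = (H r + c) / r ^ 2 := by
    filter_upwards [(ae_restrict_iff' measurableSet_Ioc).1 hae] with r hr hrm
    have h0 : u r - c = 0 := by simpa using hr hrm
    have hr0 : 0 < r := hsub' hrm
    rw [eq_div_iff (by positivity)]
    simp only [hudef] at h0
    linarith
  refine ⟨fun r => H r + c, fun r hr => ⟨?_, (hH r (hs.trans hr.1)).add_const c⟩⟩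
  have hcont : ContinuousOn (fun r => (H r + c) / r ^ 2) (Ioi 0) :=
    (hHac.continuousOn.add continuousOn_const).div (by fun_prop) fun x hx => pow_ne_zero 2 hx.ne'
  refine ((hasDerivAt_intervalIntegral_of_continuousOn hcont hs
    (hs.trans hr.1)).const_add (g s)).congr_of_eventuallyEq ?_
  filter_upwards [Ioo_mem_nhds hr.1 hr.2] with y hy
  have h1 := (hgac s y hs hy.1.le).2
  rw [intervalIntegral.integral_congr_ae (g := fun r => (H r + c) / r ^ 2) (by
    filter_upwards [hae'] with x hx hxm
    rw [uIoc_of_le hy.1.le] at hxm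
    exact hx ⟨hxm.1, hxm.2.trans hy.2.le⟩)] at h1
  linarith

theorem Constrained.pos (hκ : 0 < κ) (hq : 0 < q) (h : Constrained κ ω q a f g) :
    ∀ r ∈ Ioi (0 : ℝ), 0 < g r := by
  intro r₀ (hr₀ : 0 < r₀)
  by_contra hneg
  have hnn := h.nonneg hκ hq
  have hg0 : g r₀ = 0 := le_antisymm (not_lt.1 hneg) (hnn r₀ hr₀)
  obtain ⟨R, hgR, hR⟩ := ((h.1.g_infty.eventually (lt_mem_nhds hq)).and
    (eventually_gt_atTop r₀)).exists
  obtain ⟨p, hp⟩ := h.exists_flux hκ (s := r₀ / 2) (t := R + 1) (by linarith) (by linarith)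
  have hmem : ∀ x ∈ Icc r₀ R, x ∈ Ioo (r₀ / 2) (R + 1) := fun x hx =>
    ⟨by linarith [hx.1], by linarith [hx.2]⟩
  have hp0 : p r₀ = 0 := by
    have hmin : IsLocalMin g r₀ := by
      filter_upwards [Ioi_mem_nhds hr₀] with x hx
      rw [hg0]; exact hnn x hx
    have := hmin.hasDerivAt_eq_zero (hp r₀ (hmem r₀ ⟨le_rfl, hR.le⟩)).1
    simpa [hr₀.ne'] using this
  have hacont : ContinuousOn (fun x => 2 * (a x) ^ 2) (Icc r₀ R) :=
    continuousOn_const.mul ((h.1.locAC_a.locACIoi.continuousOn.mono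
      fun x hx => hr₀.trans_le hx.1).pow 2)
  obtain ⟨M, hM⟩ := isCompact_Icc.exists_bound_of_continuousOn hacont
  set K := max (1 / r₀ ^ 2) M with hK
  have hder : ∀ x ∈ Icc r₀ R, HasDerivAt (fun x => (g x, p x))
      (p x / x ^ 2, 2 * (a x) ^ 2 * g x) x := fun x hx =>
    (hp x (hmem x hx)).1.prodMk (hp x (hmem x hx)).2
  have hbound := norm_le_gronwallBound_of_norm_deriv_right_le (δ := 0) (K := K) (ε := 0)
    (fun x hx => (hder x hx).continuousAt.continuousWithinAt)
    (fun x hx => (hder x (Ico_subset_Icc_self hx)).hasDerivWithinAt)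
    (by simp [hg0, hp0]) ?_ R ⟨hR.le, le_rfl⟩
  · rw [gronwallBound_ε0_δ0] at hbound
    have := (norm_fst_le _).trans hbound
    simp only [Real.norm_eq_abs, abs_nonpos_iff] at this
    linarith
  · intro x hx
    have hx' := Ico_subset_Icc_self hx
    have hx0 : 0 < x := hr₀.trans_le hx.1
    have hK0 : 0 ≤ K := le_max_of_le_left (by positivity)
    rw [add_zero, Prod.norm_def, Prod.norm_def]
    refine max_le ?_ ?_
    · rw [norm_div, Real.norm_of_nonneg (by positivity : 0 ≤ x ^ 2), div_eq_inv_mul]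
      refine mul_le_mul ?_ (le_max_right _ _) (norm_nonneg _) hK0
      refine le_max_of_le_left ?_
      rw [one_div]
      gcongr
      exact hx.1
    · rw [norm_mul]
      exact mul_le_mul ((hM x hx').trans (le_max_right _ _)) (le_max_left _ _) (norm_nonneg _) hK0

theorem Constrained.lt_q (hκ : 0 < κ) (hq : 0 < q) (h : Constrained κ ω q a f g) :
    ∀ r ∈ Ioi (0 : ℝ), g r < q := by
  intro r₀ (hr₀ : 0 < r₀)
  by_contra hneg
  have hle := h.le_q hκ hq
  have hg0 : g r₀ = q := le_antisymm (hle r₀ hr₀) (not_lt.1 hneg)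
  obtain ⟨r₁, ⟨hr₁, hr₁₀⟩, har₁⟩ : ∃ r₁ ∈ Ioo 0 r₀, a r₁ ≠ 0 := by
    have h1 : ∀ᶠ x in nhdsWithin 0 (Ioi 0), a x ≠ 0 := by
      have h2 : Tendsto a (nhdsWithin 0 (Ioi 0)) (nhds 1) := by
        rw [← h.1.a_zero]
        exact (h.1.locAC_a.1 0 self_mem_Ici).mono_left (nhdsWithin_mono _ Ioi_subset_Ici_self)
      exact h2.eventually_ne one_ne_zero
    obtain ⟨x, hx, hx'⟩ := (h1.and (Ioo_mem_nhdsGT hr₀)).exists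
    exact ⟨x, hx', hx⟩
  obtain ⟨p, hp⟩ := h.exists_flux hκ (s := r₁ / 2) (t := r₀ + 1) (by linarith) (by linarith)
  have hp_zero : ∀ x ∈ Ioo (r₁ / 2) (r₀ + 1), g x = q → p x = 0 := by
    intro x hx hgx
    have hx0 : 0 < x := by linarith [hx.1]
    have hmax : IsLocalMax g x := by
      filter_upwards [Ioi_mem_nhds hx0] with y hy
      rw [hgx]; exact hle y hy
    simpa [hx0.ne'] using hmax.hasDerivAt_eq_zero (hp x hx).1
  have hr₀m : r₀ ∈ Ioo (r₁ / 2) (r₀ + 1) := ⟨by linarith, by linarith⟩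
  have hsub : Ioc (r₁ / 2) r₀ ⊆ Ioo (r₁ / 2) (r₀ + 1) := fun x hx => ⟨hx.1, by linarith [hx.2]⟩
  have hpmono : MonotoneOn p (Ioc (r₁ / 2) r₀) := by
    refine monotoneOn_of_deriv_nonneg (convex_Ioc _ _)
      (fun x hx => (hp x (hsub hx)).2.continuousAt.continuousWithinAt) ?_ ?_ <;>
    intro x hx <;> have hx := hsub (interior_subset hx)
    · exact (hp x hx).2.differentiableAt.differentiableWithinAt
    · rw [(hp x hx).2.deriv]
      have : 0 ≤ g x := h.nonneg hκ hq x (by simp only [mem_Ioi]; linarith [hx.1])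
      positivity
  have hganti : AntitoneOn g (Ioc (r₁ / 2) r₀) := by
    refine antitoneOn_of_deriv_nonpos (convex_Ioc _ _)
      (fun x hx => (hp x (hsub hx)).1.continuousAt.continuousWithinAt) ?_ ?_ <;>
    intro x hx <;> have hx := interior_subset hx
    · exact (hp x (hsub hx)).1.differentiableAt.differentiableWithinAt
    · rw [(hp x (hsub hx)).1.deriv]
      refine div_nonpos_of_nonpos_of_nonneg ?_ (sq_nonneg x)
      exact (hpmono hx ⟨hr₀m.1, le_rfl⟩ hx.2).trans_eq (hp_zero r₀ hr₀m hg0)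
  have hgq : ∀ x ∈ Ioc (r₁ / 2) r₀, g x = q := fun x hx =>
    le_antisymm (hle x (by simp only [mem_Ioi]; linarith [hx.1]))
      (hg0 ▸ hganti hx ⟨hr₀m.1, le_rfl⟩ hx.2)
  have hr₁m : r₁ ∈ Ioo (r₁ / 2) r₀ := ⟨by linarith, hr₁₀⟩
  have hp1 : HasDerivAt p 0 r₁ := by
    refine (hasDerivAt_const r₁ (0 : ℝ)).congr_of_eventuallyEq ?_
    filter_upwards [Ioo_mem_nhds hr₁m.1 hr₁m.2] with x hx
    exact hp_zero x (hsub (Ioo_subset_Ioc_self hx)) (hgq x (Ioo_subset_Ioc_self hx))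
  have := hp1.unique (hp r₁ (hsub (Ioo_subset_Ioc_self hr₁m))).2
  rw [hgq r₁ (Ioo_subset_Ioc_self hr₁m)] at this
  have : 0 < 2 * (a r₁) ^ 2 * q := by positivity
  linarith

end Constrained

section ExplicitTriple

theorem one_div_one_add_sq_le {r : ℝ} (hr : 0 < r) : 1 / (1 + r) ^ 2 ≤ (1 + r ^ 2)⁻¹ := by
  rw [one_div]
  exact inv_anti₀ (by positivity) (by nlinarith)

theorem hasDerivAt_one_div_one_add {r : ℝ} (hr : 0 < r) :
    HasDerivAt (fun x : ℝ => 1 / (1 + x)) (-(1 / (1 + r) ^ 2)) r := by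
  have h := ((hasDerivAt_id' r).const_add 1).fun_inv (by positivity)
  simpa only [one_div, neg_div] using h

theorem hasDerivAt_mul_div_one_add (c : ℝ) {r : ℝ} (hr : 0 < r) :
    HasDerivAt (fun x : ℝ => c * (x / (1 + x))) (c * (1 / (1 + r) ^ 2)) r := by
  have h := (((hasDerivAt_id' r).div ((hasDerivAt_id' r).const_add 1)
    (by positivity)).const_mul c)
  refine h.congr_deriv ?_
  ring

theorem tendsto_one_div_one_add : Tendsto (fun x : ℝ => 1 / (1 + x)) atTop (nhds 0) := by
  simpa only [one_div, Function.comp_def, id] using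
    tendsto_inv_atTop_zero.comp (tendsto_atTop_add_const_left atTop (1 : ℝ) tendsto_id)

theorem tendsto_mul_div_one_add (c : ℝ) :
    Tendsto (fun x : ℝ => c * (x / (1 + x))) atTop (nhds c) := by
  have h := (tendsto_one_div_one_add.const_sub 1).const_mul c
  rw [sub_zero, mul_one] at h
  refine h.congr' ?_
  filter_upwards [eventually_gt_atTop 0] with x hx
  have : 1 + x ≠ 0 := by positivity
  field_simp
  ring

theorem continuousOn_one_div_one_add_sq :
    ContinuousOn (fun x : ℝ => 1 / (1 + x) ^ 2) (Ioi 0) := by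
  refine continuousOn_const.div (by fun_prop) fun x (hx : 0 < x) => ?_
  positivity

theorem locAC_one_div_one_add : LocAC (fun x : ℝ => 1 / (1 + x)) := by
  refine ⟨continuousOn_const.div (by fun_prop) fun x (hx : 0 ≤ x) => by positivity, ?_⟩
  exact LocACIoi.of_hasDerivAt (fun r hr => hasDerivAt_one_div_one_add hr)
    continuousOn_one_div_one_add_sq.neg

theorem locAC_mul_div_one_add (c : ℝ) : LocAC (fun x : ℝ => c * (x / (1 + x))) := by
  refine ⟨continuousOn_const.mul
    (continuousOn_id.div (by fun_prop) fun x (hx : 0 ≤ x) => by positivity), ?_⟩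
  exact LocACIoi.of_hasDerivAt (fun r hr => hasDerivAt_mul_div_one_add c hr)
    (continuousOn_const.mul continuousOn_one_div_one_add_sq)

theorem calE1_explicit_le {κ : ℝ} (hκ : 0 < κ) (c : ℝ) {r : ℝ} (hr : 0 < r) :
    calE1 κ (fun x => 1 / (1 + x)) (fun x => c * (x / (1 + x))) r ≤
      (13 + c ^ 2 + 6 * κ * c ^ 2) * (1 / (1 + r) ^ 2) := by
  have hsin1 : Real.sin (c * (r / (1 + r))) ^ 2 ≤ 1 := Real.sin_sq_le_one _
  have hsin2 : Real.sin (c * (r / (1 + r))) ^ 2 ≤ (c * (r / (1 + r))) ^ 2 :=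
    sq_le_sq.2 Real.abs_sin_le_abs
  have hsin0 := sq_nonneg (Real.sin (c * (r / (1 + r))))
  unfold calE1
  rw [(hasDerivAt_one_div_one_add hr).deriv, (hasDerivAt_mul_div_one_add c hr).deriv]
  generalize Real.sin (c * (r / (1 + r))) ^ 2 = S at *
  rw [← one_div_pow, ← mul_one_div r (1 + r)] at *
  set y := 1 / (1 + r) with hy
  have hy0 : 0 < y := by positivity
  have hry : r * y = 1 - y := by rw [hy]; field_simp; ring
  have hy1 : y ≤ 1 := by nlinarith
  have hry1 : r * y ≤ 1 := by linarith
  have h1 : (y ^ 2 - 1) ^ 2 / r ^ 2 ≤ 4 * y ^ 2 := by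
    rw [div_le_iff₀ (by positivity)]
    calc (y ^ 2 - 1) ^ 2 = (1 + y) ^ 2 * (r * y) ^ 2 := by rw [hry]; ring
      _ ≤ 2 ^ 2 * (r * y) ^ 2 := by gcongr; linarith
      _ = 4 * y ^ 2 * r ^ 2 := by ring
  have h2 : y ^ 2 * S / r ^ 2 ≤ c ^ 2 := by
    rw [div_le_iff₀ (by positivity)]
    calc y ^ 2 * S ≤ 1 * (c * (r * y)) ^ 2 :=
          mul_le_mul (pow_le_one₀ hy0.le hy1) hsin2 hsin0 zero_le_one
      _ = c ^ 2 * r ^ 2 * y ^ 2 := by ring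
      _ ≤ c ^ 2 * r ^ 2 := mul_le_of_le_one_right (by positivity) (pow_le_one₀ hy0.le hy1)
  have h3 : (-y ^ 2) ^ 2 ≤ y ^ 2 := by
    rw [neg_sq, sq (y ^ 2)]
    exact mul_le_of_le_one_right (by positivity) (pow_le_one₀ hy0.le hy1)
  have h4 : r ^ 2 * (c * y ^ 2) ^ 2 ≤ c ^ 2 * y ^ 2 := by
    calc r ^ 2 * (c * y ^ 2) ^ 2 = c ^ 2 * y ^ 2 * (r * y) ^ 2 := by ring
      _ ≤ c ^ 2 * y ^ 2 := mul_le_of_le_one_right (by positivity)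
        (pow_le_one₀ (by positivity) hry1)
  have h5 : y ^ 2 * S ≤ y ^ 2 := mul_le_of_le_one_right (by positivity) hsin1
  have h6 : (c * y ^ 2) ^ 2 ≤ c ^ 2 := by
    rw [mul_pow, ← pow_mul]
    exact mul_le_of_le_one_right (by positivity) (pow_le_one₀ hy0.le hy1)
  have h7 : 2 * κ * y ^ 2 * S * (2 * (c * y ^ 2) ^ 2 + y ^ 2 * S / r ^ 2)
      ≤ 2 * κ * y ^ 2 * (2 * c ^ 2 + c ^ 2) := by
    rw [mul_assoc (2 * κ), mul_assoc (2 * κ), mul_assoc (2 * κ)]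
    gcongr
  nlinarith [sq_nonneg (c * y)]

theorem calE2_explicit_le (q : ℝ) {r : ℝ} (hr : 0 < r) :
    calE2 (fun x => 1 / (1 + x)) (fun x => q * (x / (1 + x))) r ≤
      (3 * q ^ 2) * (1 / (1 + r) ^ 2) := by
  unfold calE2
  rw [(hasDerivAt_mul_div_one_add q hr).deriv]
  beta_reduce
  rw [← one_div_pow, ← mul_one_div r (1 + r)]
  set y := 1 / (1 + r) with hy
  have hy0 : 0 < y := by positivity
  have hry : r * y ≤ 1 := by rw [hy, mul_one_div, div_le_one (by positivity)]; linarith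
  calc r ^ 2 * (q * y ^ 2) ^ 2 + 2 * y ^ 2 * (q * (r * y)) ^ 2
      = 3 * q ^ 2 * y ^ 2 * (r * y) ^ 2 := by ring
    _ ≤ 3 * q ^ 2 * y ^ 2 :=
      mul_le_of_le_one_right (by positivity) (pow_le_one₀ (by positivity) hry)

theorem admissible_explicit {κ ω q : ℝ} (hκ : 0 < κ) :
    Admissible κ ω q (fun x => 1 / (1 + x)) (fun x => (Real.pi - ω) * (x / (1 + x)))
      (fun x => q * (x / (1 + x))) where
  locAC_a := locAC_one_div_one_add
  locAC_f := locAC_mul_div_one_add _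
  locAC_g := locAC_mul_div_one_add _
  a_zero := by simp
  f_zero := by simp
  a_infty := tendsto_one_div_one_add
  f_infty := tendsto_mul_div_one_add _
  g_infty := tendsto_mul_div_one_add _
  finite_energy := by
    have hinv : Integrable fun r : ℝ => (1 + r ^ 2)⁻¹ := integrable_inv_one_add_sq
    refine (hinv.integrableOn.const_mul (13 + (Real.pi - ω) ^ 2 + 6 * κ * (Real.pi - ω) ^ 2
      + 3 * q ^ 2)).mono' ?_ ?_
    · have ha : Measurable fun x : ℝ => 1 / (1 + x) := by fun_prop
      have hb : ∀ c : ℝ, Measurable fun x : ℝ => c * (x / (1 + x)) := fun c => by fun_prop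
      have h1 := measurable_deriv fun x : ℝ => 1 / (1 + x)
      have h2 := measurable_deriv fun x : ℝ => (Real.pi - ω) * (x / (1 + x))
      have h3 := measurable_deriv fun x : ℝ => q * (x / (1 + x))
      have h4 := Real.measurable_sin.comp (hb (Real.pi - ω))
      simp only [Function.comp_def] at h4
      refine Measurable.aestronglyMeasurable ?_
      unfold calE1 calE2
      fun_prop
    · refine (ae_restrict_iff' measurableSet_Ioi).2 (ae_of_all _ fun r (hr : 0 < r) => ?_)
      rw [Real.norm_of_nonneg (add_nonneg (calE1_nonneg hκ r) (calE2_nonneg r))]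
      refine (add_le_add (calE1_explicit_le hκ _ hr) (calE2_explicit_le q hr)).trans ?_
      rw [← add_mul]
      exact mul_le_mul_of_nonneg_left (one_div_one_add_sq_le hr) (by positivity)

theorem integrableOn_mixed {a u v : ℝ → ℝ} (ha : ContinuousOn a (Ioi 0)) (hu : LocACIoi u)
    (hv : LocACIoi v) (hEu : IntegrableOn (calE2 a u) (Ioi 0))
    (hEv : IntegrableOn (calE2 a v) (Ioi 0)) :
    IntegrableOn (fun r => r ^ 2 * deriv u r * deriv v r + 2 * (a r) ^ 2 * u r * v r)
      (Ioi 0) := by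
  refine (hEu.add hEv).mono' ?_ (ae_of_all _ fun r => ?_)
  · refine AEStronglyMeasurable.add ?_ ?_
    · exact (((measurable_id.pow_const 2).mul (measurable_deriv u)).mul
        (measurable_deriv v)).aestronglyMeasurable
    · exact (((continuousOn_const.mul (ha.pow 2)).mul hu.continuousOn).mul
        hv.continuousOn).aestronglyMeasurable measurableSet_Ioi
  · simp only [calE2, Pi.add_apply]
    rw [Real.norm_eq_abs, abs_le]
    constructor <;>
    nlinarith [sq_nonneg (r * (deriv u r + deriv v r)), sq_nonneg (r * (deriv u r - deriv v r)),
      sq_nonneg (a r * (u r + v r)), sq_nonneg (a r * (u r - v r)), sq_nonneg (r * deriv u r),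
      sq_nonneg (r * deriv v r), sq_nonneg (a r * u r), sq_nonneg (a r * v r)]

theorem hasDerivAt_explicit_flux (q : ℝ) {r : ℝ} (hr : 0 < r) :
    HasDerivAt (fun x : ℝ => q * (x / (1 + x)) ^ 2)
      (2 * (1 / (1 + r)) ^ 2 * (q * (r / (1 + r)))) r := by
  have h := ((hasDerivAt_mul_div_one_add 1 hr).pow 2).const_mul q
  simp only [one_mul] at h
  refine h.congr_deriv ?_
  norm_num
  ring

theorem constrained_explicit {κ ω q : ℝ} (hκ : 0 < κ) (hq : 0 < q) :
    Constrained κ ω q (fun x => 1 / (1 + x)) (fun x => (Real.pi - ω) * (x / (1 + x)))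
      (fun x => q * (x / (1 + x))) := by
  have hA := admissible_explicit (ω := ω) (q := q) hκ
  refine ⟨hA, fun G hG hlim hE => ?_⟩
  have hI := integrableOn_mixed hA.locAC_a.locACIoi.continuousOn hA.locAC_g.locACIoi hG
    (hA.integrableOn_calE2 hκ) hE
  refine ⟨hI, ?_⟩
  set m : ℝ → ℝ := fun r => r ^ 2 * deriv (fun x => q * (x / (1 + x))) r * deriv G r
    + 2 * (1 / (1 + r)) ^ 2 * (q * (r / (1 + r))) * G r with hm
  set p : ℝ → ℝ := fun x => q * (x / (1 + x)) ^ 2 with hp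
  have hpac : LocACIoi p := by
    refine LocACIoi.of_hasDerivAt (fun r hr => hasDerivAt_explicit_flux q hr) ?_
    exact (continuousOn_const.mul (hA.locAC_a.locACIoi.continuousOn.pow 2)).mul
      hA.locAC_g.locACIoi.continuousOn
  have hparts : ∀ s t, 0 < s → s ≤ t → ∫ r in s..t, m r = p t * G t - p s * G s := by
    intro s t hs hst
    rw [← (locACIoi_iff.1 hpac s t hs hst).integral_deriv_mul_eq_sub (locACIoi_iff.1 hG s t hs hst)]
    refine intervalIntegral.integral_congr fun r hr => ?_
    rw [uIcc_of_le hst] at hr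
    have hr0 : 0 < r := hs.trans_le hr.1
    simp only [hm]
    rw [(hasDerivAt_mul_div_one_add q hr0).deriv, (hasDerivAt_explicit_flux q hr0).deriv]
    simp only [hp]
    field_simp
    ring
  have hpG : Tendsto (fun t => p t * G t) atTop (nhds 0) := by
    have h1 := ((tendsto_mul_div_one_add 1).pow 2).const_mul q
    simpa [hp] using h1.mul hlim
  have htail : ∀ s, 0 < s → ∫ r in Ioi s, m r = -(p s * G s) := by
    intro s hs
    have h1 := intervalIntegral_tendsto_integral_Ioi s (hI.mono_set (Ioi_subset_Ioi hs.le))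
      tendsto_id
    refine tendsto_nhds_unique h1 ?_
    rw [← zero_sub]
    refine (hpG.sub_const (p s * G s)).congr' ?_
    filter_upwards [eventually_ge_atTop s] with t hst using (hparts s t hs hst).symm
  have hzero : Tendsto (fun s => p s * G s) (nhdsWithin 0 (Ioi 0))
      (nhds (-∫ r in Ioi (0 : ℝ), m r)) := by
    have h2 : Tendsto (fun s => ∫ r in Ioi s, m r) (nhdsWithin 0 (Ioi 0))
        (nhds (∫ r in Ioi (0 : ℝ), m r)) := by
      have hcov : AECover (volume.restrict (Ioi (0 : ℝ))) (nhdsWithin 0 (Ioi 0))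
          fun s : ℝ => Ioi s := aecover_Ioi_of_Ioi (tendsto_id.mono_left nhdsWithin_le_nhds)
      refine (hcov.integral_tendsto_of_countably_generated hI).congr' ?_
      filter_upwards [self_mem_nhdsWithin] with s (hs : 0 < s)
      rw [Measure.restrict_restrict measurableSet_Ioi,
        inter_eq_left.2 (Ioi_subset_Ioi hs.le)]
    refine h2.neg.congr' ?_
    filter_upwards [self_mem_nhdsWithin] with s hs
    rw [htail s hs, neg_neg]
  by_contra hne
  set L := |∫ r in Ioi (0 : ℝ), m r| with hL
  have hL0 : 0 < L := abs_pos.2 hne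
  have hev : ∀ᶠ s in nhdsWithin (0 : ℝ) (Ioi 0), L / 2 < |p s * G s| := by
    refine hzero.abs.eventually (lt_mem_nhds ?_)
    rw [abs_neg, ← hL]; linarith
  obtain ⟨δ, hδ, hδm⟩ := (mem_nhdsGT_iff_exists_Ioo_subset).1 hev
  have hδ0 : (0 : ℝ) < δ := hδ
  set d := min δ 1
  have hd0 : 0 < d := lt_min hδ0 one_pos
  have hbad : IntegrableOn (fun r : ℝ => r⁻¹) (Ioo 0 d) := by
    have hsub : Ioo (0 : ℝ) d ⊆ Ioi 0 := fun x hx => hx.1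
    refine ((hE.mono_set hsub).const_mul (8 * q ^ 2 / L ^ 2)).mono'
      (by fun_prop) ((ae_restrict_iff' measurableSet_Ioo).2 (ae_of_all _ fun r hr => ?_))
    have hr0 : 0 < r := hr.1
    have hr1 : r < 1 := hr.2.trans_le (min_le_right _ _)
    have hlow : L / 2 < |p r * G r| := hδm ⟨hr0, hr.2.trans_le (min_le_left _ _)⟩
    rw [Real.norm_of_nonneg (by positivity)]
    set y := 1 / (1 + r) with hy
    have hy0 : 0 < y := by positivity
    have hy1 : y ≤ 1 := by rw [hy, div_le_one (by positivity)]; linarith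
    have hsq : L ^ 2 / 4 ≤ q ^ 2 * r ^ 4 * (y ^ 2 * (G r) ^ 2) := by
      calc L ^ 2 / 4 = (L / 2) ^ 2 := by ring
        _ ≤ |p r * G r| ^ 2 := pow_le_pow_left₀ (by positivity) hlow.le 2
        _ = (q ^ 2 * r ^ 4 * (y ^ 2 * (G r) ^ 2)) * y ^ 2 := by
          rw [sq_abs]; simp only [hp, hy]; ring
        _ ≤ q ^ 2 * r ^ 4 * (y ^ 2 * (G r) ^ 2) :=
          mul_le_of_le_one_right (by positivity) (pow_le_one₀ hy0.le hy1)
    have hr4 : r ^ 4 ≤ r := pow_le_of_le_one hr0.le hr1.le (by norm_num)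
    have hmain : L ^ 2 ≤ r * (8 * q ^ 2 * (r ^ 2 * deriv G r ^ 2 + 2 * y ^ 2 * G r ^ 2)) := by
      have h1 : q ^ 2 * r ^ 4 * (y ^ 2 * (G r) ^ 2) ≤ q ^ 2 * r * (y ^ 2 * (G r) ^ 2) := by gcongr
      have h2 : 0 ≤ r * (8 * q ^ 2 * (r ^ 2 * deriv G r ^ 2)) := by positivity
      have h3 : 0 ≤ q ^ 2 * r * (y ^ 2 * (G r) ^ 2) := by positivity
      nlinarith
    rw [div_mul_eq_mul_div, inv_eq_one_div, div_le_div_iff₀ hr0 (by positivity)]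
    linarith
  have := (intervalIntegrable_iff_integrableOn_Ioo_of_le hd0.le).2 hbad
  rw [intervalIntegrable_inv_iff] at this
  rcases this with h | h
  · exact hd0.ne h
  · exact h left_mem_uIcc

end ExplicitTriple

/-- `𝒞` is non-empty; moreover, for `(a,f,g) ∈ 𝒞` we have
`0 < g < q` on `(0,∞)` and `g` is the unique minimizer of `G ↦ E₂(a,G)` among
locally absolutely continuous functions on `(0,∞)` with `G(∞) = q`. -/
theorem constrained_nonempty_and_g_unique_minimizer
    (κ ω q : ℝ) (hκ : 0 < κ) (hω : ω ∈ Set.Ioo (Real.pi / 2) Real.pi) (hq : 0 < q) :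
    (∃ a f g : ℝ → ℝ, Constrained κ ω q a f g) ∧
    ∀ a f g : ℝ → ℝ, Constrained κ ω q a f g →
      (∀ r ∈ Set.Ioi (0 : ℝ), 0 < g r ∧ g r < q) ∧
      (∀ G : ℝ → ℝ, LocACIoi G → Filter.Tendsto G Filter.atTop (nhds q) →
        E2lint a g ≤ E2lint a G) ∧
      (∀ G : ℝ → ℝ, LocACIoi G → Filter.Tendsto G Filter.atTop (nhds q) →
        E2lint a G ≤ E2lint a g → Set.EqOn G g (Set.Ioi 0)) := by
  refine ⟨⟨_, _, _, constrained_explicit hκ hq⟩, fun a f g h => ⟨fun r hr =>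
    ⟨h.pos hκ hq r hr, h.lt_q hκ hq r hr⟩, fun G hG hlim => h.E2lint_le hκ hG hlim,
    fun G hG hlim hle => h.eqOn_of_E2lint_le hκ hG hlim hle⟩⟩
end
end

section
/- Let q > 0 and let a, g be continuous functions on (0,∞) such that g is twice differentiable and satisfies (r² g')' = 2 a² g on (0,∞), g(r) ≥ 0 for all r > 0, lim_{r→∞} g(r) = q, and ∫₀^∞ r² g'(r)² dr < ∞. Then r² g'(r) = ∫₀^r 2 a(ρ)² g(ρ) dρ for every r > 0; in particular g'(r) ≥ 0 so g is nondecreasing on (0,∞), and lim_{r→0⁺} g(r) = 0 provided a is continuous up to r = 0 with a(0) = 1. -/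
open Real MeasureTheory Set Filter

open scoped Topology

/-- A nonnegative derivative on an open interval gives monotonicity there. -/
theorem monotoneOn_Ioo_of_hasDerivAt_nonneg {f f' : ℝ → ℝ} {s t : ℝ}
    (hf : ∀ r ∈ Ioo s t, HasDerivAt f (f' r) r) (hf' : ∀ r ∈ Ioo s t, 0 ≤ f' r) :
    MonotoneOn f (Ioo s t) := by
  refine monotoneOn_of_deriv_nonneg (convex_Ioo s t)
    (fun r hr => (hf r hr).continuousAt.continuousWithinAt) ?_ ?_
  · rw [interior_Ioo]
    exact fun r hr => (hf r hr).differentiableAt.differentiableWithinAt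
  · rw [interior_Ioo]
    intro r hr
    rw [(hf r hr).deriv]
    exact hf' r hr

/-- A nonnegative derivative on an open half-line gives monotonicity there. -/
theorem monotoneOn_Ioi_of_hasDerivAt_nonneg {f f' : ℝ → ℝ} {s : ℝ}
    (hf : ∀ r ∈ Ioi s, HasDerivAt f (f' r) r) (hf' : ∀ r ∈ Ioi s, 0 ≤ f' r) :
    MonotoneOn f (Ioi s) := by
  intro x hx y hy hxy
  exact monotoneOn_Ioo_of_hasDerivAt_nonneg (t := y + 1) (fun r hr => hf r hr.1)
    (fun r hr => hf' r hr.1) ⟨hx, by linarith⟩ ⟨hy, by linarith⟩ hxy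

/-- If `r² u(r)²` is integrable on `(0, ∞)`, then `r² u(r)` is not bounded away from zero
near the origin. -/
theorem exists_abs_sq_mul_lt_of_integrableOn {u : ℝ → ℝ}
    (hu : IntegrableOn (fun r => r ^ 2 * u r ^ 2) (Ioi 0)) {c s : ℝ} (hc : 0 < c) (hs : 0 < s) :
    ∃ r ∈ Ioo 0 s, |r ^ 2 * u r| < c := by
  by_contra! hbd
  have hint : IntegrableOn (fun r : ℝ => r ^ (-2 : ℝ)) (Ioo 0 s) := by
    refine Integrable.mono' ((hu.mono_set Ioo_subset_Ioi_self).const_mul (c ^ 2)⁻¹)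
      (by fun_prop) ?_
    refine (ae_restrict_iff' measurableSet_Ioo).2 (Eventually.of_forall fun r hr => ?_)
    have hr0 : 0 < r := hr.1
    have hsq : c ^ 2 ≤ (r ^ 2 * u r) ^ 2 := by
      rw [← sq_abs (r ^ 2 * u r)]
      exact pow_le_pow_left₀ hc.le (hbd r hr) 2
    rw [Real.norm_of_nonneg (rpow_nonneg hr0.le _), rpow_neg hr0.le, rpow_two,
      ← div_eq_inv_mul, le_div_iff₀ (by positivity), ← div_eq_inv_mul, div_le_iff₀ (by positivity)]
    linarith
  have := (intervalIntegral.integrableOn_Ioo_rpow_iff hs).1 hint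
  norm_num at this

/-- A nonnegative function on `(0, s)` cannot satisfy `f' ≥ c / r` with `c > 0`, because of the
logarithmic divergence at the origin. -/
theorem not_forall_div_le_deriv_of_nonneg {f f' : ℝ → ℝ} {c s : ℝ} (hc : 0 < c) (hs : 0 < s)
    (hf : ∀ r ∈ Ioo 0 s, HasDerivAt f (f' r) r) (hf0 : ∀ r ∈ Ioo 0 s, 0 ≤ f r) :
    ¬ ∀ r ∈ Ioo 0 s, c / r ≤ f' r := by
  intro hle
  have hmono : MonotoneOn (fun r => f r - c * log r) (Ioo 0 s) :=
    monotoneOn_Ioo_of_hasDerivAt_nonneg (f' := fun r => f' r - c * r⁻¹)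
      (fun r hr => (hf r hr).sub ((hasDerivAt_log hr.1.ne').const_mul c))
      (fun r hr => sub_nonneg.2 (by simpa [div_eq_mul_inv] using hle r hr))
  have hlog : ∀ᶠ r in 𝓝[>] (0 : ℝ),
      log r < (c * log (s / 2) - f (s / 2)) / c := tendsto_log_nhdsGT_zero.eventually_lt_atBot _
  obtain ⟨r, hrlog, hr⟩ := (hlog.and (Ioo_mem_nhdsGT (half_pos hs))).exists
  have hrs : r ∈ Ioo 0 s := ⟨hr.1, by linarith [hr.2]⟩
  have h1 := hmono hrs ⟨half_pos hs, half_lt_self hs⟩ hr.2.le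
  have h2 := hf0 r hrs
  rw [lt_div_iff₀ hc] at hrlog
  simp only at h1
  linarith

/-- for the electric potential equation `(r² g')' = 2 a² g` with
`g ≥ 0`, `g(∞) = q` and finite weighted Dirichlet energy, one has
`r² g'(r) = ∫₀^r 2 a² g dρ`, so `g' ≥ 0` and `g` is nondecreasing on `(0,∞)`;
moreover `g(0⁺) = 0` provided `a` is continuous up to `r = 0` with `a(0) = 1`. -/
theorem g_monotone_and_vanishes_at_zero
    (q : ℝ) (hq : 0 < q) (a g : ℝ → ℝ)
    (ha : ContinuousOn a (Set.Ioi 0)) (hgc : ContinuousOn g (Set.Ioi 0))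
    (hdiff : ∀ r ∈ Set.Ioi (0 : ℝ), DifferentiableAt ℝ g r)
    (heq : ∀ r ∈ Set.Ioi (0 : ℝ),
      HasDerivAt (fun ρ => ρ ^ 2 * deriv g ρ) (2 * (a r) ^ 2 * g r) r)
    (hgpos : ∀ r ∈ Set.Ioi (0 : ℝ), 0 ≤ g r)
    (hginf : Filter.Tendsto g Filter.atTop (nhds q))
    (hfin : MeasureTheory.IntegrableOn (fun r => r ^ 2 * (deriv g r) ^ 2) (Set.Ioi 0)) :
    (∀ r ∈ Set.Ioi (0 : ℝ), r ^ 2 * deriv g r = ∫ ρ in (0 : ℝ)..r, 2 * (a ρ) ^ 2 * g ρ) ∧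
    (∀ r ∈ Set.Ioi (0 : ℝ), 0 ≤ deriv g r) ∧
    MonotoneOn g (Set.Ioi 0) ∧
    ((Filter.Tendsto a (nhdsWithin 0 (Set.Ioi 0)) (nhds 1)) →
      Filter.Tendsto g (nhdsWithin 0 (Set.Ioi 0)) (nhds 0)) := by
  have hmono : MonotoneOn (fun ρ => ρ ^ 2 * deriv g ρ) (Ioi 0) :=
    monotoneOn_Ioi_of_hasDerivAt_nonneg heq fun r hr =>
      mul_nonneg (by positivity) (hgpos r hr)
  have hflux : ∀ r ∈ Ioi (0 : ℝ), 0 ≤ r ^ 2 * deriv g r := by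
    intro r hr
    by_contra! hneg
    obtain ⟨x, hx, hxlt⟩ := exists_abs_sq_mul_lt_of_integrableOn hfin (neg_pos.2 hneg) hr
    have h1 := hmono hx.1 hr hx.2.le
    have h2 := neg_abs_le (x ^ 2 * deriv g x)
    simp only at h1
    linarith
  have hderiv : ∀ r ∈ Ioi (0 : ℝ), 0 ≤ deriv g r := fun r hr =>
    nonneg_of_mul_nonneg_right (hflux r hr) (pow_pos hr 2)
  have hgmono : MonotoneOn g (Ioi 0) :=
    monotoneOn_Ioi_of_hasDerivAt_nonneg (fun r hr => (hdiff r hr).hasDerivAt) hderiv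
  have hlim : Tendsto (fun ρ => ρ ^ 2 * deriv g ρ) (𝓝[>] 0) (𝓝 0) := by
    refine tendsto_order.2 ⟨fun c hc => ?_, fun c hc => ?_⟩
    · filter_upwards [self_mem_nhdsWithin] with r hr using hc.trans_le (hflux r hr)
    · obtain ⟨x, hx, hxlt⟩ := exists_abs_sq_mul_lt_of_integrableOn hfin hc one_pos
      filter_upwards [Ioo_mem_nhdsGT hx.1] with r hr
      exact (hmono hr.1 hx.1 hr.2.le).trans_lt ((le_abs_self _).trans_lt hxlt)
  refine ⟨fun r hr => ?_, hderiv, hgmono, fun ha0 => ?_⟩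
  · have hr0 : (0 : ℝ) < r := hr
    have hcont : ContinuousOn (fun ρ => ρ ^ 2 * deriv g ρ) (Icc 0 r) := by
      intro x hx
      rcases hx.1.eq_or_lt with rfl | hx0
      · refine ContinuousWithinAt.mono ?_ Icc_subset_Ici_self
        rw [← continuousWithinAt_Ioi_iff_Ici]
        simpa [ContinuousWithinAt] using hlim
      · exact (heq x hx0).continuousAt.continuousWithinAt
    have hint : IntervalIntegrable (fun ρ => 2 * (a ρ) ^ 2 * g ρ) volume 0 r := by
      rw [intervalIntegrable_iff_integrableOn_Ioc_of_le hr0.le]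
      exact intervalIntegral.integrableOn_deriv_of_nonneg hcont (fun x hx => heq x hx.1)
        fun x hx => mul_nonneg (by positivity) (hgpos x hx.1)
    rw [intervalIntegral.integral_eq_sub_of_hasDerivAt_of_le hr0.le hcont
      (fun x hx => heq x hx.1) hint]
    simp
  · refine tendsto_order.2 ⟨fun c hc => ?_, fun c hc => ?_⟩
    · filter_upwards [self_mem_nhdsWithin] with r hr using hc.trans_le (hgpos r hr)
    by_contra hcon
    have hgc' : ∀ r ∈ Ioi (0 : ℝ), c ≤ g r := by
      intro r hr
      by_contra! hlt
      refine hcon ?_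
      filter_upwards [Ioo_mem_nhdsGT hr] with x hx
      exact (hgmono hx.1 hr hx.2.le).trans_lt hlt
    have hsq : ∀ᶠ r in 𝓝[>] (0 : ℝ), 1 / 2 < a r ^ 2 :=
      (ha0.pow 2).eventually (lt_mem_nhds (by norm_num))
    obtain ⟨s, hs, hsub⟩ := mem_nhdsGT_iff_exists_Ioo_subset.1 hsq
    have hs0 : (0 : ℝ) < s := hs
    have hfluxmono : MonotoneOn (fun r => r ^ 2 * deriv g r - c * r) (Ioo 0 s) := by
      refine monotoneOn_Ioo_of_hasDerivAt_nonneg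
        (f' := fun r => 2 * (a r) ^ 2 * g r - c * 1)
        (fun r hr => (heq r hr.1).sub ((hasDerivAt_id r).const_mul c)) fun r hr => ?_
      have h1 : 1 / 2 < a r ^ 2 := hsub hr
      nlinarith [hgc' r hr.1]
    have hfluxlim : Tendsto (fun r => r ^ 2 * deriv g r - c * r) (𝓝[>] 0) (𝓝 0) := by
      have hid : Tendsto (fun r : ℝ => c * r) (𝓝[>] 0) (𝓝 (c * 0)) :=
        ((continuous_const_mul c).tendsto 0).mono_left nhdsWithin_le_nhds
      simpa using hlim.sub hid
    refine not_forall_div_le_deriv_of_nonneg hc hs0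
      (fun r hr => (hdiff r hr.1).hasDerivAt) (fun r hr => hgpos r hr.1) fun r hr => ?_
    have hr0 : 0 < r := hr.1
    have hge : 0 ≤ r ^ 2 * deriv g r - c * r := by
      refine le_of_tendsto hfluxlim ?_
      filter_upwards [Ioo_mem_nhdsGT hr0] with x hx
      exact hfluxmono ⟨hx.1, hx.2.trans hr.2⟩ hr hx.2.le
    rw [div_le_iff₀ hr0]
    nlinarith
end
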